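/- Let n ≥ 1, let ε ∈ {±1}ⁿ be a sign pattern, and fix a matrix C_ε ∈ TPM_n(ε). Then for every A ∈ TPM_n(ε) there exists a unique real lower triangular matrix L with strictly positive diagonal entries such that A = Lᵀ·C_ε·L. In particular, the map L ↦ Lᵀ·C_ε·L is a bijection from L_n onto TPM_n(ε). -/

import Mathlib

open Matrix

/-- The trailing principal `k × k` minor (size `k.val + 1` for `k : Fin n`). -/
def trailingMinor {n : ℕ} (A : Matrix (Fin n) (Fin n) ℝ) (k : Fin n) : ℝ :=
  (A.submatrix
    (fun i : Fin (k.val + 1) =>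
      (⟨n - (k.val + 1) + i.val, by have := i.isLt; have := k.isLt; omega⟩ : Fin n))
    (fun i : Fin (k.val + 1) =>
      (⟨n - (k.val + 1) + i.val, by have := i.isLt; have := k.isLt; omega⟩ : Fin n))).det

/-- `A ∈ TPM_n(ε)`. -/
def memTPM {n : ℕ} (ε : Fin n → ℝ) (A : Matrix (Fin n) (Fin n) ℝ) : Prop :=
  A.IsSymm ∧ ∀ k : Fin n, 0 < ε k * trailingMinor A k

/-- Membership in Cholesky space `L_n`: lower triangular with strictly positive diagonal. -/
def InCholSpace {n : ℕ} (L : Matrix (Fin n) (Fin n) ℝ) : Prop :=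
  (∀ i j : Fin n, i < j → L i j = 0) ∧ ∀ j, 0 < L j j

theorem trailingMinor_castSucc {n : ℕ} (A : Matrix (Fin (n + 1)) (Fin (n + 1)) ℝ) (k : Fin n) :
    trailingMinor A k.castSucc = trailingMinor (A.submatrix Fin.succ Fin.succ) k := by
  unfold trailingMinor
  rw [submatrix_submatrix]
  congr 2 <;>
  · funext i
    ext
    have := k.isLt
    simp only [Function.comp, Fin.val_succ, Fin.val_castSucc]
    omega

theorem trailingMinor_last {n : ℕ} (A : Matrix (Fin (n + 1)) (Fin (n + 1)) ℝ) :
    trailingMinor A (Fin.last n) = A.det := by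
  unfold trailingMinor
  congr 1
  ext i j
  simp only [submatrix_apply]
  congr 1 <;> ext <;> simp

theorem memTPM_succ_iff {n : ℕ} (ε : Fin (n + 1) → ℝ) (A : Matrix (Fin (n + 1)) (Fin (n + 1)) ℝ) :
    memTPM ε A ↔ A.IsSymm ∧ memTPM (fun k => ε k.castSucc) (A.submatrix Fin.succ Fin.succ) ∧
      0 < ε (Fin.last n) * A.det := by
  unfold memTPM
  rw [Fin.forall_fin_succ']
  simp only [trailingMinor_castSucc, trailingMinor_last]
  exact ⟨fun h => ⟨h.1, ⟨h.1.submatrix _, h.2.1⟩, h.2.2⟩, fun h => ⟨h.1, h.2.1.2, h.2.2⟩⟩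

theorem memTPM.det_ne_zero {n : ℕ} {ε : Fin n → ℝ} {A : Matrix (Fin n) (Fin n) ℝ}
    (h : memTPM ε A) : A.det ≠ 0 := by
  cases n with
  | zero => simp
  | succ n => exact right_ne_zero_of_mul ((memTPM_succ_iff ε A).1 h).2.2.ne'

theorem InCholSpace.det_pos {n : ℕ} {L : Matrix (Fin n) (Fin n) ℝ} (h : InCholSpace L) :
    0 < L.det := by
  rw [det_of_isLowerTriangular L fun i j hij => h.1 i j hij]
  exact Finset.prod_pos fun i _ => h.2 i

theorem InCholSpace.submatrix_succ {n : ℕ} {L : Matrix (Fin (n + 1)) (Fin (n + 1)) ℝ}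
    (h : InCholSpace L) : InCholSpace (L.submatrix Fin.succ Fin.succ) :=
  ⟨fun _ _ hij => h.1 _ _ (Fin.succ_lt_succ_iff.2 hij), fun _ => h.2 _⟩

theorem InCholSpace.det_succ {n : ℕ} {L : Matrix (Fin (n + 1)) (Fin (n + 1)) ℝ}
    (h : InCholSpace L) : L.det = L 0 0 * (L.submatrix Fin.succ Fin.succ).det := by
  rw [det_of_isLowerTriangular L fun i j hij => h.1 i j hij,
    det_of_isLowerTriangular _ fun i j hij => h.submatrix_succ.1 i j hij, Fin.prod_univ_succ]
  rfl

theorem InCholSpace.congr_submatrix_succ {n : ℕ} {L : Matrix (Fin (n + 1)) (Fin (n + 1)) ℝ}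
    (h : InCholSpace L) (C : Matrix (Fin (n + 1)) (Fin (n + 1)) ℝ) :
    (Lᵀ * C * L).submatrix Fin.succ Fin.succ = (L.submatrix Fin.succ Fin.succ)ᵀ *
      C.submatrix Fin.succ Fin.succ * L.submatrix Fin.succ Fin.succ := by
  ext i j
  simp [mul_apply, Fin.sum_univ_succ, h.1 0 _ (Fin.succ_pos _)]

theorem InCholSpace.congr_col_zero {n : ℕ} {L : Matrix (Fin (n + 1)) (Fin (n + 1)) ℝ}
    (h : InCholSpace L) (C : Matrix (Fin (n + 1)) (Fin (n + 1)) ℝ) :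
    (fun i : Fin n => (Lᵀ * C * L) i.succ 0) = (L.submatrix Fin.succ Fin.succ)ᵀ *ᵥ
      (L 0 0 • (fun i : Fin n => C i.succ 0) +
        C.submatrix Fin.succ Fin.succ *ᵥ fun i : Fin n => L i.succ 0) := by
  ext i
  rw [Matrix.mul_assoc]
  simp [mul_apply, mulVec, dotProduct, Fin.sum_univ_succ, h.1 0 _ (Fin.succ_pos _), mul_comm]

theorem det_congr {n : ℕ} (L C : Matrix (Fin n) (Fin n) ℝ) :
    (Lᵀ * C * L).det = C.det * L.det ^ 2 := by
  rw [det_mul, det_mul, det_transpose]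
  ring

theorem isSymm_congr {n : ℕ} {C : Matrix (Fin n) (Fin n) ℝ} (hC : C.IsSymm)
    (L : Matrix (Fin n) (Fin n) ℝ) : (Lᵀ * C * L).IsSymm := by
  rw [IsSymm, transpose_mul, transpose_mul, transpose_transpose, hC.eq, Matrix.mul_assoc]

/-- A symmetric matrix is determined by its determinant and its entries off the top left corner,
provided the complementary minor of that corner does not vanish. -/
theorem eq_of_det_eq_of_submatrix_succ_eq {n : ℕ} {A B : Matrix (Fin (n + 1)) (Fin (n + 1)) ℝ}
    (hA : A.IsSymm) (hB : B.IsSymm)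
    (hsub : A.submatrix Fin.succ Fin.succ = B.submatrix Fin.succ Fin.succ)
    (hcol : ∀ i : Fin n, A i.succ 0 = B i.succ 0) (hdet : A.det = B.det)
    (hne : (A.submatrix Fin.succ Fin.succ).det ≠ 0) : A = B := by
  have hlow : ∀ (i : Fin n) (j : Fin (n + 1)), A i.succ j = B i.succ j := fun i j => by
    cases j using Fin.cases with
    | zero => exact hcol i
    | succ j => exact congrFun (congrFun hsub i) j
  have hrow : ∀ j : Fin n, A 0 j.succ = B 0 j.succ := fun j => by
    rw [← hA.apply, ← hB.apply, hcol]
  have hminor : ∀ f : Fin n → Fin (n + 1), A.submatrix Fin.succ f = B.submatrix Fin.succ f :=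
    fun f => by ext i j; exact hlow i (f j)
  have hcorner : A 0 0 = B 0 0 := by
    rw [det_succ_row_zero, det_succ_row_zero, Fin.sum_univ_succ, Fin.sum_univ_succ] at hdet
    simp only [hrow, hminor, add_left_inj] at hdet
    rw [hsub] at hne
    simpa [hne] using hdet
  ext i j
  cases i using Fin.cases with
  | zero =>
    cases j using Fin.cases with
    | zero => exact hcorner
    | succ j => exact hrow j
  | succ i => exact hlow i j

theorem InCholSpace.memTPM_congr {n : ℕ} {ε : Fin n → ℝ} {C L : Matrix (Fin n) (Fin n) ℝ}
    (hL : InCholSpace L) (hC : memTPM ε C) : memTPM ε (Lᵀ * C * L) := by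
  induction n with
  | zero => exact ⟨isSymm_congr hC.1 L, fun k => k.elim0⟩
  | succ n ih =>
    rw [memTPM_succ_iff] at hC ⊢
    refine ⟨isSymm_congr hC.1 L, ?_, ?_⟩
    · rw [hL.congr_submatrix_succ]
      exact ih hL.submatrix_succ hC.2.1
    · rw [det_congr, ← mul_assoc]
      exact mul_pos hC.2.2 (pow_pos hL.det_pos 2)

theorem InCholSpace.congr_injective {n : ℕ} {ε : Fin n → ℝ} {C L M : Matrix (Fin n) (Fin n) ℝ}
    (hC : memTPM ε C) (hL : InCholSpace L) (hM : InCholSpace M)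
    (h : Lᵀ * C * L = Mᵀ * C * M) : L = M := by
  induction n with
  | zero => exact Subsingleton.elim _ _
  | succ n ih =>
    have hCdet := hC.det_ne_zero
    rw [memTPM_succ_iff] at hC
    have hsub : L.submatrix Fin.succ Fin.succ = M.submatrix Fin.succ Fin.succ :=
      ih hC.2.1 hL.submatrix_succ hM.submatrix_succ <| by
        rw [← hL.congr_submatrix_succ, ← hM.congr_submatrix_succ, h]
    have hcorner : L 0 0 = M 0 0 := by
      have hdet := congrArg det h
      rw [det_congr, det_congr] at hdet
      have := (pow_left_inj₀ hL.det_pos.le hM.det_pos.le two_ne_zero).1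
        (mul_left_cancel₀ hCdet hdet)
      rw [hL.det_succ, hM.det_succ, hsub] at this
      exact mul_right_cancel₀ hM.submatrix_succ.det_pos.ne' this
    have hcol : (fun i : Fin n => L i.succ 0) = fun i => M i.succ 0 := by
      have hc := hL.congr_col_zero C
      rw [h, hM.congr_col_zero C, hsub, hcorner] at hc
      have hMdet : IsUnit (M.submatrix Fin.succ Fin.succ)ᵀ := by
        rw [isUnit_iff_isUnit_det, det_transpose]
        exact hM.submatrix_succ.det_pos.ne'.isUnit
      have hCunit : IsUnit (C.submatrix Fin.succ Fin.succ) := by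
        rw [isUnit_iff_isUnit_det]
        exact hC.2.1.det_ne_zero.isUnit
      exact (mulVec_injective_of_isUnit hCunit
        (add_left_cancel (mulVec_injective_of_isUnit hMdet hc))).symm
    ext i j
    cases j using Fin.cases with
    | zero =>
      cases i using Fin.cases with
      | zero => exact hcorner
      | succ i => exact congrFun hcol i
    | succ j =>
      cases i using Fin.cases with
      | zero => rw [hL.1 _ _ (Fin.succ_pos j), hM.1 _ _ (Fin.succ_pos j)]
      | succ i => exact congrFun (congrFun hsub i) j

theorem memTPM.exists_eq_congr {n : ℕ} {ε : Fin n → ℝ} {C A : Matrix (Fin n) (Fin n) ℝ}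
    (hC : memTPM ε C) (hA : memTPM ε A) :
    ∃ L : Matrix (Fin n) (Fin n) ℝ, InCholSpace L ∧ A = Lᵀ * C * L := by
  induction n with
  | zero => exact ⟨1, ⟨fun i => i.elim0, fun i => i.elim0⟩, Subsingleton.elim _ _⟩
  | succ n ih =>
    have hCdet := hC.det_ne_zero
    rw [memTPM_succ_iff] at hC hA
    obtain ⟨L', hL', hA'⟩ := ih hC.2.1 hA.2.1
    have hratio : 0 < A.det / C.det := by
      rw [← mul_div_mul_left _ _ (left_ne_zero_of_mul hC.2.2.ne')]
      exact div_pos hA.2.2 hC.2.2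
    have hL'det := hL'.det_pos
    set l : ℝ := √(A.det / C.det) / L'.det with hl
    have hlpos : 0 < l := div_pos (Real.sqrt_pos.2 hratio) hL'det
    set w : Fin n → ℝ := (C.submatrix Fin.succ Fin.succ)⁻¹ *ᵥ
      ((L'ᵀ)⁻¹ *ᵥ (fun i => A i.succ 0) - l • fun i => C i.succ 0) with hw
    let L : Matrix (Fin (n + 1)) (Fin (n + 1)) ℝ :=
      of (Fin.cons (Fin.cons l 0) fun i => Fin.cons (w i) (L' i))
    have hsub : L.submatrix Fin.succ Fin.succ = L' := by
      ext i j
      simp [L]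
    have hL : InCholSpace L := by
      refine ⟨fun i j hij => ?_, fun j => ?_⟩
      · cases j using Fin.cases with
        | zero => exact absurd hij (Fin.not_lt_zero i)
        | succ j =>
          cases i using Fin.cases with
          | zero => simp [L]
          | succ i => simpa [L] using hL'.1 i j (Fin.succ_lt_succ_iff.1 hij)
      · cases j using Fin.cases with
        | zero => simpa [L] using hlpos
        | succ j => simpa [L] using hL'.2 j
    have hL00 : L 0 0 = l := by simp [L]
    have hLcol : (fun i : Fin n => L i.succ 0) = w := by
      ext i
      simp [L]
    refine ⟨L, hL, eq_of_det_eq_of_submatrix_succ_eq hA.1 (isSymm_congr hC.1 L) ?_ ?_ ?_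
      hA.2.1.det_ne_zero⟩
    · rw [hL.congr_submatrix_succ, hsub, hA']
    · have hcol := hL.congr_col_zero C
      rw [hsub, hL00, hLcol, hw, mulVec_mulVec, mul_nonsing_inv _ hC.2.1.det_ne_zero.isUnit,
        one_mulVec, add_sub_cancel, mulVec_mulVec,
        mul_nonsing_inv _ (by rw [det_transpose]; exact hL'det.ne'.isUnit), one_mulVec] at hcol
      exact fun i => (congrFun hcol i).symm
    · rw [det_congr, hL.det_succ, hsub, hL00, hl, div_mul_cancel₀ _ hL'det.ne',
        Real.sq_sqrt hratio.le, mul_div_cancel₀ _ hCdet]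

/-- Fix `C ∈ TPM_n(ε)`.  Every `A ∈ TPM_n(ε)` admits a unique reverse
Cholesky-type factorization `A = Lᵀ * C * L` with `L ∈ L_n`; in particular
`L ↦ Lᵀ * C * L` is a bijection from `L_n` onto `TPM_n(ε)`. -/
theorem stmt7 (n : ℕ) (hn : 1 ≤ n) (ε : Fin n → ℝ)
    (hε : ∀ k, ε k = 1 ∨ ε k = -1)
    (C : Matrix (Fin n) (Fin n) ℝ) (hC : memTPM ε C) :
    (∀ A : Matrix (Fin n) (Fin n) ℝ, memTPM ε A →
      ∃! L : Matrix (Fin n) (Fin n) ℝ, InCholSpace L ∧ A = Lᵀ * C * L) ∧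
    Set.BijOn (fun L => Lᵀ * C * L) {L | InCholSpace L} {A | memTPM ε A} := by
  refine ⟨fun A hA => ?_, fun L hL => hL.memTPM_congr hC,
    fun L hL M hM h => InCholSpace.congr_injective hC hL hM h, fun A hA => ?_⟩
  · obtain ⟨L, hL, rfl⟩ := hC.exists_eq_congr hA
    exact ⟨L, ⟨hL, rfl⟩, fun M hM => InCholSpace.congr_injective hC hM.1 hL hM.2.symm⟩
  · obtain ⟨L, hL, rfl⟩ := hC.exists_eq_congr hA
    exact ⟨L, hL, rfl⟩
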